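/- Two full-rank matrices over F₂ with the same matroid have the same row space: let 1 ≤ r ≤ n and let A, A′ be r × n matrices over ZMod 2, each of rank r. Suppose that for every subset I ⊆ Fin n with |I| = r, the columns of A indexed by I are linearly independent if and only if the columns of A′ indexed by I are linearly independent. Then the row space of A equals the row space of A′ (equivalently, A′ = T·A for some invertible r × r matrix T over ZMod 2). -/

import Mathlib

namespace Matrix

variable {m n R K : Type*}

theorem submatrix_id_update [DecidableEq m] (A : Matrix m n R) (f : m → n) (i : m) (j : n) :
    A.submatrix id (Function.update f i j) = (A.submatrix id f).updateCol i (A.col j) := by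
  ext x y
  by_cases hy : y = i <;> simp [hy]

theorem span_range_mul_le [Fintype m] [CommRing R] (B : Matrix m m R) (A : Matrix m n R) :
    Submodule.span R (Set.range (B * A)) ≤ Submodule.span R (Set.range A) := by
  rw [Submodule.span_le]
  rintro _ ⟨i, rfl⟩
  rw [SetLike.mem_coe, mul_apply_eq_vecMul, vecMul_eq_sum]
  exact Submodule.sum_mem _ fun k _ =>
    Submodule.smul_mem _ _ (Submodule.subset_span (Set.mem_range_self k))

variable [Fintype m] [DecidableEq m]

/-- The product of the adjugate of a maximal square submatrix with the whole matrix has maximal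
minors as entries. -/
theorem adjugate_submatrix_mul_apply [CommRing R] (A : Matrix m n R) (f : m → n)
    (i : m) (j : n) :
    ((A.submatrix id f).adjugate * A) i j = (A.submatrix id (Function.update f i j)).det := by
  rw [submatrix_id_update, ← cramer_apply, cramer_eq_adjugate_mulVec]
  rfl

/-- If two matrices have the same maximal minors, one of which is a unit, then the row space of
the first is contained in that of the second. -/
theorem span_range_le_of_det_submatrix_eq [CommRing R] {A B : Matrix m n R}
    (h : ∀ f : m → n, (A.submatrix id f).det = (B.submatrix id f).det)
    {f : m → n} (hf : IsUnit (A.submatrix id f).det) :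
    Submodule.span R (Set.range A) ≤ Submodule.span R (Set.range B) := by
  set M := A.submatrix id f
  have key : M.adjugate * A = (B.submatrix id f).adjugate * B := by
    ext i j
    simp only [M, adjugate_submatrix_mul_apply, h]
  obtain ⟨c, hc⟩ := hf.exists_left_inv
  have hA : A = (c • M * (B.submatrix id f).adjugate) * B := by
    rw [Matrix.mul_assoc, ← key, ← Matrix.mul_assoc, smul_mul, mul_adjugate, smul_smul, hc,
      one_smul, Matrix.one_mul]
  rw [hA]
  exact span_range_mul_le _ _

theorem det_submatrix_ne_zero_iff [Field K] [DecidableEq n] (A : Matrix m n K) (f : m → n) :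
    (A.submatrix id f).det ≠ 0 ↔ Function.Injective f ∧
      LinearIndependent K (fun i : Finset.univ.image f => (fun x => A x i.val)) := by
  rw [← isUnit_iff_ne_zero, ← isUnit_iff_isUnit_det, ← linearIndependent_cols_iff_isUnit]
  have hcol : (A.submatrix id f).col = A.col ∘ f := rfl
  have hcoe : ((Finset.univ.image f : Finset n) : Set n) = Set.range f := by simp
  have himage : LinearIndependent K (fun i : Finset.univ.image f => (fun x => A x i.val)) ↔
      LinearIndepOn K A.col (Set.range f) := by
    rw [← hcoe]
    rfl
  rw [hcol, himage]
  constructor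
  · intro hli
    have hf : Function.Injective f := hli.injective.of_comp
    exact ⟨hf, (linearIndepOn_range_iff hf A.col).2 hli⟩
  · rintro ⟨hf, hli⟩
    exact (linearIndepOn_range_iff hf A.col).1 hli

theorem exists_det_submatrix_ne_zero [Field K] [Fintype n] {A : Matrix m n K}
    (hA : A.rank = Fintype.card m) : ∃ f : m → n, (A.submatrix id f).det ≠ 0 := by
  rw [rank_eq_finrank_span_cols] at hA
  obtain ⟨g, hg, -, hli⟩ := Submodule.exists_fun_fin_finrank_span_eq K (Set.range A.col)
  choose f hf using hg
  let e : m ≃ Fin (Module.finrank K (Submodule.span K (Set.range A.col))) :=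
    Fintype.equivFinOfCardEq hA.symm
  refine ⟨f ∘ e, ?_⟩
  rw [← isUnit_iff_ne_zero, ← isUnit_iff_isUnit_det, ← linearIndependent_cols_iff_isUnit]
  have hcol : (A.submatrix id (f ∘ e)).col = g ∘ e := funext fun i => hf (e i)
  rw [hcol]
  exact hli.comp e e.injective

end Matrix

/-- Two full-rank `r × n` matrices over `F₂` realizing the same matroid have the same
row space. -/
theorem rowSpace_eq_of_same_matroid (r n : ℕ) (hr : 1 ≤ r) (hrn : r ≤ n)
    (A A' : Matrix (Fin r) (Fin n) (ZMod 2)) (hA : A.rank = r) (hA' : A'.rank = r)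
    (h : ∀ I : Finset (Fin n), I.card = r →
      (LinearIndependent (ZMod 2) (fun i : I => (fun x => A x i.val)) ↔
        LinearIndependent (ZMod 2) (fun i : I => (fun x => A' x i.val)))) :
    Submodule.span (ZMod 2) (Set.range A) = Submodule.span (ZMod 2) (Set.range A') := by
  have hdet : ∀ f : Fin r → Fin n, (A.submatrix id f).det = (A'.submatrix id f).det := by
    intro f
    have hiff : (A.submatrix id f).det ≠ 0 ↔ (A'.submatrix id f).det ≠ 0 := by
      rw [Matrix.det_submatrix_ne_zero_iff, Matrix.det_submatrix_ne_zero_iff]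
      refine and_congr_right fun hf => h _ ?_
      rw [Finset.card_image_of_injective _ hf, Finset.card_fin]
    have hZMod : ∀ a b : ZMod 2, (a ≠ 0 ↔ b ≠ 0) → a = b := by decide
    exact hZMod _ _ hiff
  obtain ⟨f, hf⟩ := Matrix.exists_det_submatrix_ne_zero (A := A) (by simpa using hA)
  obtain ⟨f', hf'⟩ := Matrix.exists_det_submatrix_ne_zero (A := A') (by simpa using hA')
  exact le_antisymm
    (Matrix.span_range_le_of_det_submatrix_eq hdet hf.isUnit)
    (Matrix.span_range_le_of_det_submatrix_eq (fun f => (hdet f).symm) hf'.isUnit)
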